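/- Fix a universal Turing machine T and a universal self-delimiting Turing machine U. There exists a self-delimiting Turing machine V such that ζ_V is asymptotically random but not random: for any binary digit sequence x with ζ_V = ∑_{i≥0} (x i)·2^{-(i+1)}, for every computable real s > 1 there is a constant c ≥ 0 with K_T(x_0 ⋯ x_{m−1}) ≥ m/s − c for all m ≥ 1, yet there is no constant c' ≥ 0 with H_U(x_0 ⋯ x_{m−1}) ≥ m − c' for all m ≥ 1. -/

import Mathlib

open scoped ENNReal

/-- The domain of a Turing machine (a partial function on binary strings). -/
def dom (f : List Bool →. List Bool) : Set (List Bool) := {p | (f p).Dom}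

/-- A machine is self-delimiting if its domain is prefix-free. -/
def SelfDelim (f : List Bool →. List Bool) : Prop :=
  ∀ p ∈ dom f, ∀ q ∈ dom f, p <+: q → p = q

/-- Chaitin's Omega number of a machine, in `[0,∞]`. -/
noncomputable def Omega (f : List Bool →. List Bool) : ℝ≥0∞ :=
  ∑' p : dom f, (2 : ℝ≥0∞)⁻¹ ^ (p : List Bool).length

/-- `bin n` is the binary expansion of `n` with the leading 1 removed. -/
def bin (n : ℕ) : List Bool := (Nat.bits n).reverse.tail

/-- `Υ[A]`: the set of positive integers whose `bin`-code lies in `A`. -/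
def Ups (A : Set (List Bool)) : Set ℕ := {n | 1 ≤ n ∧ bin n ∈ A}

/-- The zeta number of a machine, in `[0,∞]`. -/
noncomputable def zeta (f : List Bool →. List Bool) : ℝ≥0∞ :=
  ∑' n : Ups (dom f), ((n : ℕ) : ℝ≥0∞)⁻¹

/-- `U` is a universal self-delimiting Turing machine. -/
def UnivSD (U : List Bool →. List Bool) : Prop :=
  SelfDelim U ∧ ∀ C : List Bool →. List Bool, Partrec C → SelfDelim C →
    ∃ c : ℕ, ∀ x ∈ dom C, ∃ p : List Bool, p.length ≤ x.length + c ∧ U p = C x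

/-- `T` is a universal (plain) Turing machine. -/
def UnivTM (T : List Bool →. List Bool) : Prop :=
  ∀ C : List Bool →. List Bool, Partrec C →
    ∃ c : ℕ, ∀ x ∈ dom C, ∃ p : List Bool, p.length ≤ x.length + c ∧ T p = C x

/-- Program-size / plain complexity of a string w.r.t. a machine. -/
noncomputable def Cpx (f : List Bool →. List Bool) (y : List Bool) : ℕ :=
  sInf {n : ℕ | ∃ w : List Bool, w.length = n ∧ y ∈ f w}

/-- Natural complexity of a string w.r.t. a machine, with `min ∅ = ∞`. -/
noncomputable def nabla (f : List Bool →. List Bool) (y : List Bool) : ℝ≥0∞ :=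
  sInf {c : ℝ≥0∞ | ∃ n : ℕ, 1 ≤ n ∧ y ∈ f (bin n) ∧ c = (n : ℝ≥0∞)}

/-- The real number with binary digit sequence `x`. -/
noncomputable def realDigits (x : ℕ → Bool) : ℝ :=
  ∑' i : ℕ, (if x i then (1 : ℝ) else 0) * (2 : ℝ)⁻¹ ^ (i + 1)

/-- The extended nonnegative real with binary digit sequence `x`. -/
noncomputable def ennDigits (x : ℕ → Bool) : ℝ≥0∞ :=
  ∑' i : ℕ, (if x i then (1 : ℝ≥0∞) else 0) * (2 : ℝ≥0∞)⁻¹ ^ (i + 1)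

/-- The string of the first `m` digits of the sequence `x`. -/
def prefixStr (x : ℕ → Bool) (m : ℕ) : List Bool := (List.range m).map x

/-- A real is computable if it is approximated to within `2⁻ⁿ` by a computable
sequence of rationals. -/
def ComputableReal (s : ℝ) : Prop :=
  ∃ f : ℕ → ℚ, Computable f ∧ ∀ n : ℕ, |s - (f n : ℝ)| ≤ (2 : ℝ)⁻¹ ^ n

/-! ### Binary strings as positive integers -/

/-- The positive integer coded by a binary string: prepend a leading `1`. -/
def unbin (l : List Bool) : ℕ := l.foldl (fun a b => 2 * a + b.toNat) 1

@[simp] lemma unbin_nil : unbin [] = 1 := rfl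

lemma unbin_concat (l : List Bool) (b : Bool) : unbin (l ++ [b]) = 2 * unbin l + b.toNat := by
  simp [unbin]

lemma unbin_pos (l : List Bool) : 1 ≤ unbin l := by
  induction l using List.reverseRecOn with
  | nil => simp
  | append_singleton l b ih => rw [unbin_concat]; omega

@[simp] lemma bin_one : bin 1 = [] := by simp [bin]

lemma bin_bit (n : ℕ) (hn : 1 ≤ n) (b : Bool) : bin (2 * n + b.toNat) = bin n ++ [b] := by
  have h : (2 * n + b.toNat).bits = b :: n.bits := by
    have := Nat.bits_append_bit n b (by omega)
    rwa [Nat.bit_val] at this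
  have hne : n.bits.reverse ≠ [] := by
    rw [Ne, List.reverse_eq_nil_iff, ← List.length_eq_zero_iff, Nat.size_eq_bits_len,
      Nat.size_eq_zero]
    omega
  simp only [bin, h, List.reverse_cons]
  exact List.tail_append_of_ne_nil hne

lemma bin_unbin (l : List Bool) : bin (unbin l) = l := by
  induction l using List.reverseRecOn with
  | nil => simp
  | append_singleton l b ih => rw [unbin_concat, bin_bit _ (unbin_pos l), ih]

lemma bin_rec (n : ℕ) (hn : 2 ≤ n) : bin n = bin (n / 2) ++ [decide (n % 2 = 1)] := by
  have h := bin_bit (n / 2) (by omega) (decide (n % 2 = 1))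
  rw [← h]
  congr 1
  rcases Nat.mod_two_eq_zero_or_one n with h' | h' <;> simp [h'] <;> omega

lemma unbin_bin (n : ℕ) (hn : 1 ≤ n) : unbin (bin n) = n := by
  induction n using Nat.strong_induction_on with
  | _ n ih =>
    rcases Nat.lt_or_ge n 2 with h | h
    · obtain rfl : n = 1 := by omega
      simp
    · rw [bin_rec n h, unbin_concat, ih (n / 2) (by omega) (by omega)]
      rcases Nat.mod_two_eq_zero_or_one n with h' | h' <;> simp [h'] <;> omega

lemma two_pow_length_le_unbin (l : List Bool) : 2 ^ l.length ≤ unbin l := by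
  induction l using List.reverseRecOn with
  | nil => simp
  | append_singleton l b ih => rw [unbin_concat, List.length_append]; simp [pow_succ]; omega

lemma unbin_lt (l : List Bool) : unbin l < 2 ^ (l.length + 1) := by
  induction l using List.reverseRecOn with
  | nil => simp
  | append_singleton l b ih =>
    rw [unbin_concat, List.length_append]
    have : b.toNat ≤ 1 := Bool.toNat_le b
    simp only [List.length_singleton, pow_succ] at *
    omega

lemma length_bin {m n : ℕ} (h : 2 ^ m ≤ n) (h' : n < 2 ^ (m + 1)) : (bin n).length = m := by
  have h1 : 1 ≤ n := Nat.one_le_two_pow.trans h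
  have h2 := two_pow_length_le_unbin (bin n)
  have h3 := unbin_lt (bin n)
  rw [unbin_bin n h1] at h2 h3
  have h4 := (Nat.pow_lt_pow_iff_right (a := 2) (by norm_num)).1 (h.trans_lt h3)
  have h5 := (Nat.pow_lt_pow_iff_right (a := 2) (by norm_num)).1 (h2.trans_lt h')
  omega

lemma unbin_append_div (l r : List Bool) : unbin (l ++ r) / 2 ^ r.length = unbin l := by
  induction r using List.reverseRecOn with
  | nil => simp
  | append_singleton r b ih =>
    rw [← List.append_assoc, unbin_concat, List.length_append, List.length_singleton, pow_succ',
      ← Nat.div_div_eq_div_mul]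
    have : b.toNat ≤ 1 := Bool.toNat_le b
    rw [show (2 * unbin (l ++ r) + b.toNat) / 2 = unbin (l ++ r) by omega, ih]

lemma bin_injective {m n : ℕ} (hm : 1 ≤ m) (hn : 1 ≤ n) (h : bin m = bin n) : m = n := by
  rw [← unbin_bin m hm, h, unbin_bin n hn]

/-! ### Trees of binary strings defined by a condition on all prefixes -/

/-- `InTree Ok m n` says that `n` codes a string of length `m` all of whose nonempty prefixes
satisfy `Ok`. -/
def InTree (Ok : ℕ → ℕ → Prop) : ℕ → ℕ → Prop
  | 0, n => n = 1
  | m + 1, n => InTree Ok m (n / 2) ∧ Ok (m + 1) n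

lemma InTree.bounds {Ok : ℕ → ℕ → Prop} {m n : ℕ} (h : InTree Ok m n) :
    2 ^ m ≤ n ∧ n < 2 ^ (m + 1) := by
  induction m generalizing n with
  | zero => have : n = 1 := h; subst this; simp
  | succ m ih =>
    have := ih h.1
    simp only [pow_succ] at *
    omega

lemma InTree.mono {Ok Ok' : ℕ → ℕ → Prop} (hO : ∀ i n, Ok i n → Ok' i n) {m n : ℕ}
    (h : InTree Ok m n) : InTree Ok' m n := by
  induction m generalizing n with
  | zero => exact h
  | succ m ih => exact ⟨ih h.1, hO _ _ h.2⟩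

lemma tree_iff {Ok : ℕ → ℕ → Prop} {m n : ℕ} :
    InTree Ok m n ↔ n / 2 ^ m = 1 ∧ ∀ i < m, Ok (m - i) (n / 2 ^ i) := by
  induction m generalizing n with
  | zero => simp [InTree]
  | succ m ih =>
    rw [InTree, ih, Nat.div_div_eq_div_mul, ← pow_succ', and_assoc, and_congr_right_iff]
    intro _
    constructor
    · rintro ⟨h1, h2⟩ i hi
      rcases i with _ | i
      · simpa using h2
      · have := h1 i (by omega)
        rw [Nat.div_div_eq_div_mul, ← pow_succ'] at this
        simpa using this
    · intro h
      refine ⟨fun i hi => ?_, by simpa using h 0 (by omega)⟩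
      rw [Nat.div_div_eq_div_mul, ← pow_succ']
      simpa using h (i + 1) (by omega)

lemma InTree.div {Ok : ℕ → ℕ → Prop} {m j n : ℕ} (h : InTree Ok (m + j) n) :
    InTree Ok m (n / 2 ^ j) := by
  induction j generalizing n with
  | zero => simpa using h
  | succ j ih =>
    rw [pow_succ', ← Nat.div_div_eq_div_mul]
    exact ih h.1

lemma InTree.last {Ok : ℕ → ℕ → Prop} {m n : ℕ} (hm : 1 ≤ m) (h : InTree Ok m n) : Ok m n := by
  obtain ⟨m, rfl⟩ : ∃ k, m = k + 1 := ⟨m - 1, by omega⟩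
  exact h.2

open Classical in
/-- The strings of length `m` in the tree. -/
noncomputable def level (Ok : ℕ → ℕ → Prop) (m : ℕ) : Finset ℕ :=
  (Finset.range (2 ^ (m + 1))).filter (InTree Ok m)

lemma mem_level {Ok : ℕ → ℕ → Prop} {m n : ℕ} : n ∈ level Ok m ↔ InTree Ok m n := by
  simp only [level, Finset.mem_filter, Finset.mem_range, and_iff_right_iff_imp]
  exact fun h => h.bounds.2

/-- The digit at each square position is forced, alternately to `0` and `1`. -/
def Pat (i n : ℕ) : Prop := Nat.sqrt i * Nat.sqrt i = i → n % 2 = (Nat.sqrt i + 1) % 2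

lemma sqrt_succ_cases (m : ℕ) :
    (Nat.sqrt (m + 1) * Nat.sqrt (m + 1) = m + 1 ∧ Nat.sqrt (m + 1) = Nat.sqrt m + 1) ∨
    (Nat.sqrt (m + 1) * Nat.sqrt (m + 1) ≠ m + 1 ∧ Nat.sqrt (m + 1) = Nat.sqrt m) := by
  have h1 := Nat.sqrt_le (m + 1)
  have h2 := Nat.sqrt_le m
  have h4 := Nat.lt_succ_sqrt m
  have h5 := Nat.lt_succ_sqrt (m + 1)
  have h6 := Nat.sqrt_succ_le_succ_sqrt m
  have h7 : Nat.sqrt m ≤ Nat.sqrt (m + 1) := Nat.sqrt_le_sqrt (Nat.le_succ m)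
  rcases Nat.lt_or_ge (Nat.sqrt m) (Nat.sqrt (m + 1)) with h | h
  · left
    have h8 : Nat.sqrt (m + 1) = Nat.sqrt m + 1 := by simp only [Nat.succ_eq_add_one] at *; omega
    refine ⟨?_, h8⟩
    simp only [Nat.succ_eq_add_one, h8] at *
    omega
  · right
    have h8 : Nat.sqrt (m + 1) = Nat.sqrt m := by omega
    refine ⟨?_, h8⟩
    rw [h8]
    omega

/-- The one-digit extensions of the strings in `s` that respect the forced digit at position
`m + 1`. -/
def patExt (m : ℕ) (s : Finset ℕ) : Finset ℕ :=
  if Nat.sqrt (m + 1) * Nat.sqrt (m + 1) = m + 1 then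
    s.image (fun n => 2 * n + (Nat.sqrt (m + 1) + 1) % 2)
  else s.image (fun n => 2 * n) ∪ s.image (fun n => 2 * n + 1)

lemma mem_patExt {m n : ℕ} {s : Finset ℕ} : n ∈ patExt m s ↔ n / 2 ∈ s ∧ Pat (m + 1) n := by
  unfold patExt Pat
  split_ifs with h
  · simp only [Finset.mem_image, h, forall_true_left]
    constructor
    · rintro ⟨k, hk, rfl⟩
      refine ⟨?_, by omega⟩
      rwa [show (2 * k + (Nat.sqrt (m + 1) + 1) % 2) / 2 = k by omega]
    · rintro ⟨h1, h2⟩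
      exact ⟨_, h1, by omega⟩
  · simp only [Finset.mem_union, Finset.mem_image, h, IsEmpty.forall_iff, and_true]
    constructor
    · rintro (⟨k, hk, rfl⟩ | ⟨k, hk, rfl⟩)
      · rwa [show 2 * k / 2 = k by omega]
      · rwa [show (2 * k + 1) / 2 = k by omega]
    · intro h1
      rcases Nat.mod_two_eq_zero_or_one n with h' | h'
      · exact Or.inl ⟨_, h1, by omega⟩
      · exact Or.inr ⟨_, h1, by omega⟩

lemma card_patExt (m : ℕ) (s : Finset ℕ) :
    (patExt m s).card * 2 ^ Nat.sqrt (m + 1) = 2 * (s.card * 2 ^ Nat.sqrt m) := by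
  unfold patExt
  rcases sqrt_succ_cases m with ⟨h1, h2⟩ | ⟨h1, h2⟩
  · rw [if_pos h1, Finset.card_image_of_injective _ (fun a b h => by simpa using h), h2, pow_succ]
    ring
  · rw [if_neg h1, Finset.card_union_of_disjoint, Finset.card_image_of_injective _
      (fun a b h => by simpa using h), Finset.card_image_of_injective _
      (fun a b h => by simpa using h), h2]
    · ring
    · rw [Finset.disjoint_left]
      simp only [Finset.mem_image]
      rintro a ⟨x, -, rfl⟩ ⟨y, -, h⟩
      omega

lemma level_pat_succ (m : ℕ) : level Pat (m + 1) = patExt m (level Pat m) := by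
  ext n
  rw [mem_level, mem_patExt, mem_level, InTree]

lemma card_level_pat (m : ℕ) : (level Pat m).card * 2 ^ Nat.sqrt m = 2 ^ m := by
  induction m with
  | zero =>
    have : level Pat 0 = {1} := by ext n; rw [mem_level]; simp [InTree]
    simp [this]
  | succ m ih => rw [level_pat_succ, card_patExt, ih, pow_succ']

lemma succ_le_two_pow_sqrt (m : ℕ) : m + 1 ≤ 2 ^ (2 * Nat.sqrt m) := by
  have h4 := Nat.lt_succ_sqrt m
  have h : Nat.sqrt m + 1 ≤ 2 ^ Nat.sqrt m := Nat.lt_two_pow_self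
  calc m + 1 ≤ (Nat.sqrt m + 1) * (Nat.sqrt m + 1) := h4
    _ ≤ 2 ^ Nat.sqrt m * 2 ^ Nat.sqrt m := Nat.mul_le_mul h h
    _ = _ := by rw [two_mul, pow_add]

/-- If few strings of each length are excluded, the tree has strings of every length. -/
lemma exists_tree {Bad : ℕ → ℕ → Prop} (B : ℕ → Finset ℕ) (hB : ∀ i n, Bad i n → n ∈ B i)
    (hcard : ∀ i, (B i).card * 32 ^ Nat.sqrt i ≤ 2 ^ i) (m : ℕ) :
    ∃ n, InTree (fun i n => Pat i n ∧ ¬ Bad i n) m n := by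
  set Ok : ℕ → ℕ → Prop := fun i n => Pat i n ∧ ¬ Bad i n with hOk
  have key : ∀ m, 2 ^ m ≤ (m + 1) * ((level Ok m).card * 2 ^ Nat.sqrt m) := by
    intro m
    induction m with
    | zero =>
      have : level Ok 0 = {1} := by ext n; rw [mem_level]; simp [InTree]
      simp [this]
    | succ m ih =>
      have hsub : patExt m (level Ok m) ⊆ level Ok (m + 1) ∪ B (m + 1) := by
        intro n hn
        rw [mem_patExt, mem_level] at hn
        by_cases hb : Bad (m + 1) n
        · exact Finset.mem_union_right _ (hB _ _ hb)
        · exact Finset.mem_union_left _ (mem_level.2 ⟨hn.1, hn.2, hb⟩)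
      have h1 := (Finset.card_le_card hsub).trans (Finset.card_union_le _ _)
      have h2 := card_patExt m (level Ok m)
      have h3 := hcard (m + 1)
      have h4 := succ_le_two_pow_sqrt (m + 1)
      have h5 : (m + 1) * (m + 2) * 2 ^ Nat.sqrt (m + 1) ≤ 32 ^ Nat.sqrt (m + 1) := by
        calc (m + 1) * (m + 2) * 2 ^ Nat.sqrt (m + 1)
            ≤ 2 ^ (2 * Nat.sqrt (m + 1)) * 2 ^ (2 * Nat.sqrt (m + 1)) * 2 ^ Nat.sqrt (m + 1) := by
              gcongr
              omega
          _ = 32 ^ Nat.sqrt (m + 1) := by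
              rw [← pow_add, ← pow_add, show (32 : ℕ) = 2 ^ 5 by norm_num, ← pow_mul]
              congr 1
              ring
      set R := 2 ^ Nat.sqrt (m + 1)
      set G := (level Ok m).card * 2 ^ Nat.sqrt m
      set D := (patExt m (level Ok m)).card
      set G' := (level Ok (m + 1)).card
      set b := (B (m + 1)).card
      have h6 : b * ((m + 1) * (m + 2) * R) ≤ 2 ^ (m + 1) := (Nat.mul_le_mul_left b h5).trans h3
      have h7 : D * R ≤ (G' + b) * R := Nat.mul_le_mul_right R h1
      rw [pow_succ] at *
      have h8 : (m + 2) * (2 * 2 ^ m) ≤ (m + 2) * (2 * ((m + 1) * G)) := by gcongr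
      have h9 : (m + 1) * (m + 2) * (D * R) ≤ (m + 1) * (m + 2) * ((G' + b) * R) := by gcongr
      rw [h2] at h9
      have h10 : (m + 1) * (2 ^ m * 2) ≤ (m + 1) * ((m + 1 + 1) * (G' * R)) := by nlinarith
      exact Nat.le_of_mul_le_mul_left h10 (by omega)
  have h := key m
  have : (level Ok m).card ≠ 0 := by
    intro h0
    rw [h0] at h
    simp at h
  obtain ⟨n, hn⟩ := Finset.card_ne_zero.1 this
  exact ⟨n, mem_level.1 hn⟩

/-! ### Leftmost paths and digit sequences -/

open Filter Topology

lemma exists_eventually_eq {f : ℕ → ℕ} (hf : Monotone f) {b : ℕ} (hb : ∀ n, f n ≤ b) :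
    ∃ y N, ∀ n ≥ N, f n = y := by
  obtain ⟨N, hN⟩ := Nat.sSup_mem (Set.range_nonempty f) ⟨b, by rintro _ ⟨n, rfl⟩; exact hb n⟩
  refine ⟨_, N, fun n hn => le_antisymm ?_ (hN ▸ hf hn)⟩
  exact le_csSup ⟨b, by rintro _ ⟨n, rfl⟩; exact hb n⟩ ⟨n, rfl⟩

lemma dyadic_bounds_of_tendsto {Z : ℕ → ℕ} {β : ℝ}
    (hZ : Tendsto (fun s => (Z s : ℝ) / 2 ^ s) atTop (𝓝 β)) {m y N : ℕ}
    (hy : ∀ s ≥ N, Z s / 2 ^ (s - m) = y) :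
    (y : ℝ) / 2 ^ m ≤ β ∧ β ≤ (y + 1) / 2 ^ m := by
  have key : ∀ s ≥ max N m, (y : ℝ) / 2 ^ m ≤ Z s / 2 ^ s ∧
      (Z s : ℝ) / 2 ^ s ≤ (y + 1) / 2 ^ m := by
    intro s hs
    have h := hy s (le_of_max_le_left hs)
    obtain ⟨j, rfl⟩ := Nat.exists_eq_add_of_le (le_of_max_le_right hs)
    rw [Nat.add_sub_cancel_left, Nat.div_eq_iff (by positivity)] at h
    have hp : 1 ≤ 2 ^ j := Nat.one_le_two_pow
    have h1 : (y : ℝ) * 2 ^ j ≤ Z (m + j) := by exact_mod_cast h.1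
    have h2 : (Z (m + j) : ℝ) ≤ (y + 1) * 2 ^ j := by
      have : Z (m + j) ≤ (y + 1) * 2 ^ j := by rw [add_mul]; omega
      exact_mod_cast this
    rw [pow_add]
    constructor
    · rw [div_le_div_iff₀ (by positivity) (by positivity)]
      nlinarith [pow_pos (two_pos (α := ℝ)) m]
    · rw [div_le_div_iff₀ (by positivity) (by positivity)]
      nlinarith [pow_pos (two_pos (α := ℝ)) m]
  exact ⟨ge_of_tendsto hZ (eventually_atTop.2 ⟨_, fun s hs => (key s hs).1⟩),
    le_of_tendsto hZ (eventually_atTop.2 ⟨_, fun s hs => (key s hs).2⟩)⟩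

/-- A sequence of approximations to the leftmost infinite path of a tree converges digit by
digit, and the limit path is on the tree. -/
lemma exists_path {Ok : ℕ → ℕ → ℕ → Prop} (hOk : ∀ s s' i n, s ≤ s' → Ok s' i n → Ok s i n)
    {A : ℕ → ℕ} (hA : ∀ s, InTree (Ok s) s (A s)) (hmono : ∀ s, 2 * A s ≤ A (s + 1)) (m : ℕ) :
    ∃ y N, (∀ s ≥ N, A s / 2 ^ (s - m) = y) ∧ InTree (fun i n => ∀ s, Ok s i n) m y := by
  have hf : Monotone fun k => A (m + k) / 2 ^ k := by
    refine monotone_nat_of_le_succ fun k => ?_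
    have := hmono (m + k)
    rw [pow_succ', ← Nat.div_div_eq_div_mul]
    refine Nat.div_le_div_right ?_
    rw [← add_assoc]
    omega
  have hb : ∀ k, A (m + k) / 2 ^ k ≤ 2 ^ (m + 1) := fun k => ((hA (m + k)).div).bounds.2.le
  obtain ⟨y, N, hy⟩ := exists_eventually_eq hf hb
  refine ⟨y, m + N, fun s hs => ?_, ?_⟩
  · have := hy (s - m) (by omega)
    simpa [Nat.add_sub_cancel' (show m ≤ s by omega)] using this
  · have h : ∀ s, InTree (Ok s) m y := by
      intro s
      have h1 := (hA (m + (N + s))).div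
      rw [hy (N + s) (by omega)] at h1
      exact h1.mono fun i n => hOk _ _ _ _ (by omega)
    rw [tree_iff]
    exact ⟨(tree_iff.1 (h 0)).1, fun i hi s => (tree_iff.1 (h s)).2 i hi⟩

/-- A path with forced digits has a unique binary expansion. -/
lemma path_unique {A : ℕ → ℕ} {β : ℝ} (hA : Tendsto (fun s => (A s : ℝ) / 2 ^ s) atTop (𝓝 β))
    (hpath : ∀ m, ∃ y N, (∀ s ≥ N, A s / 2 ^ (s - m) = y) ∧ InTree Pat m y)
    {X : ℕ → ℕ} (hX : Tendsto (fun s => (X s : ℝ) / 2 ^ s) atTop (𝓝 β))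
    (hX' : ∀ m, X (m + 1) / 2 = X m) (m : ℕ) : ∃ N, ∀ s ≥ N, A s / 2 ^ (s - m) = X m := by
  have hXd : ∀ m j, X (m + j) / 2 ^ j = X m := by
    intro m j
    induction j with
    | zero => simp
    | succ j ih => rw [pow_succ', ← Nat.div_div_eq_div_mul, ← add_assoc, hX', ih]
  choose Y N hY hYP using hpath
  have hYd : ∀ m j, Y (m + j) / 2 ^ j = Y m := by
    intro m j
    set s := max (N m) (max (N (m + j)) (m + j)) with hs
    have h1 := hY m s (by omega)
    have h2 := hY (m + j) s (by omega)
    rw [← h1, ← h2, Nat.div_div_eq_div_mul, ← pow_add]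
    congr 2
    omega
  have hXb := dyadic_bounds_of_tendsto (m := m) (y := X m) (N := m) hX (fun s hs => by
    obtain ⟨j, rfl⟩ := Nat.exists_eq_add_of_le hs
    rw [Nat.add_sub_cancel_left, hXd])
  have hYb := fun m => dyadic_bounds_of_tendsto hA (hY m)
  -- the digits at the next two square positions make the bounds strict
  have hpar : ∀ k, m < k * k → 0 < k → ∃ j, k * k = m + j ∧ (2 : ℕ) ∣ 2 ^ j ∧
      Y (m + j) % 2 = (k + 1) % 2 ∧ Y m * 2 ^ j ≤ Y (m + j) ∧
      Y (m + j) + 1 ≤ (Y m + 1) * 2 ^ j := by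
    intro k hk hk0
    obtain ⟨j, hj⟩ := Nat.exists_eq_add_of_le hk.le
    have h1 := (hYP (k * k)).last (Nat.mul_pos hk0 hk0)
    simp only [Pat, Nat.sqrt_eq, forall_true_left] at h1
    have h2 := hYd m j
    have hp : 1 ≤ 2 ^ j := Nat.one_le_two_pow
    rw [Nat.div_eq_iff (by positivity)] at h2
    refine ⟨j, hj, dvd_pow_self 2 (by omega), hj ▸ h1, h2.1, ?_⟩
    rw [add_mul]
    omega
  have hlow : (Y m : ℝ) / 2 ^ m < β := by
    obtain ⟨j, hj, ⟨d, hd⟩, h1, h2, h3⟩ := hpar (2 * (m + 1)) (by nlinarith) (by omega)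
    refine lt_of_lt_of_le ?_ (hYb (m + j)).1
    have h4 : Y m * 2 ^ j < Y (m + j) := by
      refine lt_of_le_of_ne h2 fun h => ?_
      rw [← h, hd, show Y m * (2 * d) = 2 * (Y m * d) by ring] at h1
      omega
    have h5 : (Y m : ℝ) * 2 ^ j < Y (m + j) := by exact_mod_cast h4
    rw [pow_add, div_lt_div_iff₀ (by positivity) (by positivity)]
    nlinarith [pow_pos (two_pos (α := ℝ)) m]
  have hupp : β < ((Y m : ℝ) + 1) / 2 ^ m := by
    obtain ⟨j, hj, ⟨d, hd⟩, h1, h2, h3⟩ := hpar (2 * m + 1) (by nlinarith) (by omega)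
    refine lt_of_le_of_lt (hYb (m + j)).2 ?_
    have h4 : Y (m + j) + 1 < (Y m + 1) * 2 ^ j := by
      refine lt_of_le_of_ne h3 fun h => ?_
      rw [hd, show (Y m + 1) * (2 * d) = 2 * ((Y m + 1) * d) by ring] at h
      omega
    have h5 : (Y (m + j) : ℝ) + 1 < (Y m + 1) * 2 ^ j := by exact_mod_cast h4
    rw [pow_add, div_lt_div_iff₀ (by positivity) (by positivity)]
    nlinarith [pow_pos (two_pos (α := ℝ)) m]
  have h1 := hXb.1.trans_lt hupp
  have h2 := hlow.trans_le hXb.2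
  rw [div_lt_div_iff_of_pos_right (by positivity)] at h1 h2
  have h3 : X m < Y m + 1 := by exact_mod_cast h1
  have h4 : Y m < X m + 1 := by exact_mod_cast h2
  have h5 : X m = Y m := by omega
  exact ⟨N m, h5 ▸ hY m⟩

lemma prefixStr_succ (x : ℕ → Bool) (m : ℕ) : prefixStr x (m + 1) = prefixStr x m ++ [x m] := by
  simp [prefixStr, List.range_succ]

lemma unbin_prefixStr_div (x : ℕ → Bool) (m : ℕ) :
    unbin (prefixStr x (m + 1)) / 2 = unbin (prefixStr x m) := by
  rw [prefixStr_succ, unbin_concat]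
  have := Bool.toNat_le (x m)
  omega

lemma sum_digits (x : ℕ → Bool) (m : ℕ) :
    ∑ i ∈ Finset.range m, (if x i then (1 : ℝ≥0∞) else 0) * (2 : ℝ≥0∞)⁻¹ ^ (i + 1) =
      ENNReal.ofReal (unbin (prefixStr x m) / 2 ^ m - 1) := by
  induction m with
  | zero => simp [prefixStr]
  | succ m ih =>
    have h0 : (0 : ℝ) ≤ unbin (prefixStr x m) / 2 ^ m - 1 := by
      have := two_pow_length_le_unbin (prefixStr x m)
      rw [sub_nonneg, one_le_div (by positivity)]
      simp only [prefixStr, List.length_map, List.length_range] at this ⊢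
      exact_mod_cast this
    have h2 : (2 : ℝ≥0∞)⁻¹ ^ (m + 1) = ENNReal.ofReal ((2 : ℝ)⁻¹ ^ (m + 1)) := by
      rw [ENNReal.ofReal_pow (by positivity), ENNReal.ofReal_inv_of_pos two_pos]
      simp
    rw [Finset.sum_range_succ, ih, prefixStr_succ, unbin_concat]
    cases x m
    · simp only [Bool.false_eq_true, if_false, zero_mul, add_zero, Bool.toNat_false]
      congr 1
      push_cast
      field_simp
      ring
    · rw [if_pos rfl, one_mul, h2, ← ENNReal.ofReal_add h0 (by positivity)]
      congr 1
      rw [inv_pow, pow_succ]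
      push_cast [Bool.toNat_true]
      field_simp
      ring

lemma tendsto_prefixStr {x : ℕ → Bool} {β : ℝ} (hβ : 1 ≤ β)
    (hx : ennDigits x = ENNReal.ofReal (β - 1)) :
    Tendsto (fun m => (unbin (prefixStr x m) : ℝ) / 2 ^ m) atTop (𝓝 β) := by
  have h := ENNReal.tendsto_nat_tsum
    fun i => (if x i then (1 : ℝ≥0∞) else 0) * (2 : ℝ≥0∞)⁻¹ ^ (i + 1)
  simp only [sum_digits] at h
  rw [show (∑' i, (if x i then (1 : ℝ≥0∞) else 0) * (2 : ℝ≥0∞)⁻¹ ^ (i + 1)) = _ from hx] at h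
  have h' := ((ENNReal.tendsto_toReal ENNReal.ofReal_ne_top).comp h).add_const 1
  rw [ENNReal.toReal_ofReal (by linarith), sub_add_cancel] at h'
  refine h'.congr fun m => ?_
  have := two_pow_length_le_unbin (prefixStr x m)
  have h0 : (0 : ℝ) ≤ unbin (prefixStr x m) / 2 ^ m - 1 := by
    rw [sub_nonneg, one_le_div (by positivity)]
    simp only [prefixStr, List.length_map, List.length_range] at this ⊢
    exact_mod_cast this
  simp [ENNReal.toReal_ofReal h0]

/-! ### Representing a left-computable real as a zeta number -/

/-- The state `(L, n, p, q)` of the greedy construction: `n` codes the next free string, of length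
`L`, and `p / q` is the sum of the reciprocals chosen so far. -/
abbrev GState : Type := ℕ × ℕ × ℕ × ℕ

/-- The string coded by `n` is chosen when this keeps the sum below the `L`-th approximation
`A L / 2 ^ L - 1` of the target. -/
def Emits (A : ℕ → ℕ) (x : GState) : Prop :=
  2 ^ x.1 * (x.2.2.2 + x.2.1 * x.2.2.1) ≤ (A x.1 - 2 ^ x.1) * (x.2.1 * x.2.2.2)

instance (A : ℕ → ℕ) (x : GState) : Decidable (Emits A x) := by unfold Emits; infer_instance

/-- One step of the greedy construction. -/
def greedyStep (A : ℕ → ℕ) (x : GState) : GState :=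
  if Emits A x then (x.1, x.2.1 + 1, x.2.2.1 * x.2.1 + x.2.2.2, x.2.2.2 * x.2.1)
  else (x.1 + 1, 2 * x.2.1, x.2.2.1, x.2.2.2)

/-- The states of the greedy construction. -/
def greedy (A : ℕ → ℕ) (t : ℕ) : GState := Nat.rec (0, 1, 0, 1) (fun _ x => greedyStep A x) t

/-- The sum of the chosen reciprocals. -/
noncomputable def GState.sum (x : GState) : ℝ := x.2.2.1 / x.2.2.2

section Greedy

variable {A : ℕ → ℕ}

lemma greedy_succ (t : ℕ) : greedy A (t + 1) = greedyStep A (greedy A t) := rfl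

lemma greedyStep_of_emits {x : GState} (h : Emits A x) :
    greedyStep A x = (x.1, x.2.1 + 1, x.2.2.1 * x.2.1 + x.2.2.2, x.2.2.2 * x.2.1) := if_pos h

lemma greedyStep_of_not_emits {x : GState} (h : ¬ Emits A x) :
    greedyStep A x = (x.1 + 1, 2 * x.2.1, x.2.2.1, x.2.2.2) := if_neg h

lemma greedy_pos (t : ℕ) : 0 < (greedy A t).2.1 ∧ 0 < (greedy A t).2.2.2 := by
  induction t with
  | zero => simp [greedy]
  | succ t ih =>
    rw [greedy_succ]
    by_cases h : Emits A (greedy A t)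
    · rw [greedyStep_of_emits h]
      exact ⟨Nat.succ_pos _, Nat.mul_pos ih.2 ih.1⟩
    · rw [greedyStep_of_not_emits h]
      exact ⟨by dsimp; omega, ih.2⟩

lemma sum_greedy_succ (t : ℕ) : (greedy A (t + 1)).sum =
    (greedy A t).sum + if Emits A (greedy A t) then ((greedy A t).2.1 : ℝ)⁻¹ else 0 := by
  have hp := greedy_pos (A := A) t
  have h1 : ((greedy A t).2.1 : ℝ) ≠ 0 := by exact_mod_cast hp.1.ne'
  have h2 : ((greedy A t).2.2.2 : ℝ) ≠ 0 := by exact_mod_cast hp.2.ne'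
  rw [greedy_succ]
  by_cases h : Emits A (greedy A t)
  · rw [greedyStep_of_emits h, if_pos h]
    simp only [GState.sum]
    push_cast
    field_simp
  · rw [greedyStep_of_not_emits h, if_neg h, add_zero]
    rfl

lemma emits_iff (hA : ∀ L, 2 ^ L ≤ A L) (t : ℕ) : Emits A (greedy A t) ↔
    (greedy A t).sum + ((greedy A t).2.1 : ℝ)⁻¹ ≤
      (A (greedy A t).1 : ℝ) / 2 ^ (greedy A t).1 - 1 := by
  have hp := greedy_pos (A := A) t
  have h1 : (0 : ℝ) < (greedy A t).2.1 := by exact_mod_cast hp.1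
  have h2 : (0 : ℝ) < (greedy A t).2.2.2 := by exact_mod_cast hp.2
  have h3 : ((A (greedy A t).1 - 2 ^ (greedy A t).1 : ℕ) : ℝ) =
      A (greedy A t).1 - 2 ^ (greedy A t).1 := by
    rw [Nat.cast_sub (hA _)]; push_cast; rfl
  rw [Emits, ← Nat.cast_le (α := ℝ)]
  simp only [Nat.cast_mul, Nat.cast_add, h3, GState.sum]
  push_cast
  rw [div_sub_one (by positivity), ← one_div, div_add_div _ _ h2.ne' h1.ne',
    div_le_div_iff₀ (by positivity) (by positivity)]
  constructor <;> intro h <;> linarith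

lemma succ_le_greedy (t : ℕ) : t + 1 ≤ (greedy A t).2.1 := by
  induction t with
  | zero => simp [greedy]
  | succ t ih =>
    rw [greedy_succ]
    by_cases h : Emits A (greedy A t)
    · rw [greedyStep_of_emits h]
      dsimp; omega
    · rw [greedyStep_of_not_emits h]
      dsimp; omega

lemma greedy_le {t t' : ℕ} (h : t ≤ t') : (greedy A t).1 ≤ (greedy A t').1 ∧
    (greedy A t).2.1 * 2 ^ ((greedy A t').1 - (greedy A t).1) ≤ (greedy A t').2.1 := by
  induction t', h using Nat.le_induction with
  | base => simp
  | succ t' h ih =>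
    rw [greedy_succ]
    by_cases h : Emits A (greedy A t')
    · rw [greedyStep_of_emits h]
      exact ⟨ih.1, ih.2.trans (Nat.le_succ _)⟩
    · rw [greedyStep_of_not_emits h]
      refine ⟨ih.1.trans (Nat.le_succ _), ?_⟩
      dsimp only
      rw [Nat.succ_sub ih.1, pow_succ]
      have := ih.2
      nlinarith

lemma greedy_lt {t t' : ℕ} (ht : Emits A (greedy A t)) (h : t < t') :
    (greedy A t).1 ≤ (greedy A t').1 ∧
    ((greedy A t).2.1 + 1) * 2 ^ ((greedy A t').1 - (greedy A t).1) ≤ (greedy A t').2.1 := by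
  have := greedy_le (A := A) h
  rwa [Nat.succ_eq_add_one, greedy_succ, greedyStep_of_emits ht] at this

lemma approx_monotone (hmono : ∀ L, 2 * A L ≤ A (L + 1)) :
    Monotone fun L => (A L : ℝ) / 2 ^ L := by
  refine monotone_nat_of_le_succ fun L => ?_
  have : (2 : ℝ) * A L ≤ A (L + 1) := by exact_mod_cast hmono L
  rw [div_le_div_iff₀ (by positivity) (by positivity), pow_succ]
  nlinarith [pow_pos (two_pos (α := ℝ)) L]

lemma sum_greedy_le (hA : ∀ L, 2 ^ L ≤ A L) (hmono : ∀ L, 2 * A L ≤ A (L + 1)) (t : ℕ) :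
    (greedy A t).sum ≤ (A (greedy A t).1 : ℝ) / 2 ^ (greedy A t).1 - 1 := by
  induction t with
  | zero =>
    have : (1 : ℝ) ≤ A 0 := by exact_mod_cast hA 0
    simpa [greedy, GState.sum] using this
  | succ t ih =>
    rw [sum_greedy_succ]
    by_cases h : Emits A (greedy A t)
    · rw [if_pos h, greedy_succ, greedyStep_of_emits h]
      exact (emits_iff hA t).1 h
    · rw [if_neg h, add_zero, greedy_succ, greedyStep_of_not_emits h]
      refine ih.trans ?_
      have := approx_monotone hmono (Nat.le_succ (greedy A t).1)
      simp only [Nat.succ_eq_add_one] at this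
      dsimp only
      linarith

/-- The free strings never run out. -/
lemma greedy_bounds (hA : ∀ L, 2 ^ L ≤ A L) (hmono : ∀ L, 2 * A L ≤ A (L + 1))
    (hhalf : ∀ L, 2 * A L < 3 * 2 ^ L) (t : ℕ) :
    2 ^ (greedy A t).1 ≤ (greedy A t).2.1 ∧ (greedy A t).2.1 < 2 ^ ((greedy A t).1 + 1) := by
  have hlt : ∀ t, ((greedy A t).2.1 : ℝ) ≤ 2 ^ (greedy A t).1 * (1 + 2 * (greedy A t).sum) →
      (greedy A t).2.1 < 2 ^ ((greedy A t).1 + 1) := by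
    intro t h
    have h1 := sum_greedy_le hA hmono t
    have h2 : (2 : ℝ) * A (greedy A t).1 < 3 * 2 ^ (greedy A t).1 := by
      exact_mod_cast hhalf (greedy A t).1
    have h3 : (A (greedy A t).1 : ℝ) / 2 ^ (greedy A t).1 < 3 / 2 := by
      rw [div_lt_div_iff₀ (by positivity) (by positivity)]
      linarith
    have h4 : ((greedy A t).2.1 : ℝ) < 2 ^ ((greedy A t).1 + 1) := by
      rw [pow_succ]
      refine h.trans_lt ?_
      gcongr
      linarith
    exact_mod_cast h4
  refine ⟨?_, hlt t ?_⟩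
  · have := (greedy_le (A := A) (Nat.zero_le t)).2
    simpa [greedy] using this
  · induction t with
    | zero => simp [greedy, GState.sum]
    | succ t ih =>
      have h1 := hlt t ih
      rw [sum_greedy_succ, greedy_succ]
      by_cases h : Emits A (greedy A t)
      · rw [if_pos h, greedyStep_of_emits h]
        push_cast
        have hp : (0 : ℝ) < (greedy A t).2.1 := by exact_mod_cast (greedy_pos t).1
        have h2 : (1 : ℝ) ≤ 2 ^ (greedy A t).1 * (2 * ((greedy A t).2.1 : ℝ)⁻¹) := by
          rw [← mul_assoc, ← div_eq_mul_inv, one_le_div hp, ← pow_succ]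
          exact_mod_cast h1.le
        nlinarith
      · rw [if_neg h, greedyStep_of_not_emits h, add_zero]
        push_cast
        rw [pow_succ]
        linarith

lemma sum_greedy_monotone : Monotone fun t => (greedy A t).sum := by
  refine monotone_nat_of_le_succ fun t => ?_
  rw [sum_greedy_succ, le_add_iff_nonneg_right]
  split_ifs <;> positivity

/-- Every length is completed at some step. -/
lemma exists_not_emits (hA : ∀ L, 2 ^ L ≤ A L) (hmono : ∀ L, 2 * A L ≤ A (L + 1))
    (hhalf : ∀ L, 2 * A L < 3 * 2 ^ L) (M : ℕ) :
    ∃ t, (greedy A t).1 = M ∧ ¬ Emits A (greedy A t) := by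
  have hex : ∃ t, M < (greedy A t).1 := by
    refine ⟨2 ^ (M + 1), ?_⟩
    have h1 := (greedy_bounds hA hmono hhalf (2 ^ (M + 1))).2
    have h2 := succ_le_greedy (A := A) (2 ^ (M + 1))
    by_contra! h
    have h3 : 2 ^ ((greedy A (2 ^ (M + 1))).1 + 1) ≤ 2 ^ (M + 1) :=
      Nat.pow_le_pow_right (by norm_num) (by omega)
    omega
  classical
  have hs := Nat.find_spec hex
  rcases h0 : Nat.find hex with _ | t
  · rw [h0] at hs
    simp [greedy] at hs
  · have hm : ¬ M < (greedy A t).1 := Nat.find_min hex (by omega)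
    rw [h0, greedy_succ] at hs
    by_cases h : Emits A (greedy A t)
    · rw [greedyStep_of_emits h] at hs
      exact absurd hs hm
    · rw [greedyStep_of_not_emits h] at hs
      exact ⟨t, by dsimp at hs; omega, h⟩

lemma tendsto_sum_greedy (hA : ∀ L, 2 ^ L ≤ A L) (hmono : ∀ L, 2 * A L ≤ A (L + 1))
    (hhalf : ∀ L, 2 * A L < 3 * 2 ^ L) {β : ℝ}
    (hβ : Tendsto (fun s => (A s : ℝ) / 2 ^ s) atTop (𝓝 β)) :
    Tendsto (fun t => (greedy A t).sum) atTop (𝓝 (β - 1)) := by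
  refine tendsto_atTop_isLUB sum_greedy_monotone ⟨?_, fun b hb => ?_⟩
  · rintro _ ⟨t, rfl⟩
    have h1 := sum_greedy_le hA hmono t
    have h2 := (approx_monotone hmono).ge_of_tendsto hβ (greedy A t).1
    dsimp only at h2 ⊢
    linarith
  · have h1 : ∀ M, (A M : ℝ) / 2 ^ M - 1 - (2⁻¹ : ℝ) ^ M ≤ b := by
      intro M
      obtain ⟨t, rfl, ht⟩ := exists_not_emits hA hmono hhalf M
      rw [emits_iff hA, not_le] at ht
      have h2 : (greedy A t).sum ≤ b := hb ⟨t, rfl⟩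
      have h3 : ((greedy A t).2.1 : ℝ)⁻¹ ≤ (2⁻¹ : ℝ) ^ (greedy A t).1 := by
        rw [inv_pow]
        apply inv_anti₀ (by positivity)
        exact_mod_cast (greedy_bounds hA hmono hhalf t).1
      linarith
    have h2 : Tendsto (fun M => (A M : ℝ) / 2 ^ M - 1 - (2⁻¹ : ℝ) ^ M) atTop (𝓝 (β - 1 - 0)) :=
      (hβ.sub_const 1).sub (tendsto_pow_atTop_nhds_zero_of_lt_one (by norm_num) (by norm_num))
    rw [sub_zero] at h2
    exact le_of_tendsto' h2 h1

lemma greedy_injOn (hA : ∀ L, 2 ^ L ≤ A L) (hmono : ∀ L, 2 * A L ≤ A (L + 1))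
    (hhalf : ∀ L, 2 * A L < 3 * 2 ^ L) {t t' : ℕ} (ht : Emits A (greedy A t))
    (ht' : Emits A (greedy A t'))
    (h : bin (greedy A t).2.1 <+: bin (greedy A t').2.1) : t = t' := by
  have b := greedy_bounds hA hmono hhalf t
  have b' := greedy_bounds hA hmono hhalf t'
  have l := length_bin b.1 b.2
  have l' := length_bin b'.1 b'.2
  have hll := h.length_le
  rw [l, l'] at hll
  obtain ⟨r, hr⟩ := h
  have hd := unbin_append_div (bin (greedy A t).2.1) r
  have hrl : r.length = (greedy A t').1 - (greedy A t).1 := by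
    have := congrArg List.length hr
    rw [List.length_append, l, l'] at this
    omega
  rw [hr, unbin_bin _ (greedy_pos _).1, unbin_bin _ (greedy_pos _).1, hrl] at hd
  rcases lt_trichotomy t t' with hlt | rfl | hlt
  · have := (greedy_lt ht hlt).2
    rw [← Nat.le_div_iff_mul_le (by positivity)] at this
    omega
  · rfl
  · have h1 := greedy_lt ht' hlt
    have h2 : (greedy A t').1 = (greedy A t).1 := le_antisymm h1.1 hll
    rw [h2] at h1 hd
    simp at h1 hd
    omega

/-- The machine whose domain consists of the chosen strings. -/
def greedyMachine (A : ℕ → ℕ) (p : List Bool) : Part (List Bool) :=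
  (Nat.rfind fun t => Part.some (decide (Emits A (greedy A t) ∧ (greedy A t).2.1 = unbin p))).map
    fun _ => []

lemma mem_dom_greedyMachine {p : List Bool} :
    p ∈ dom (greedyMachine A) ↔ ∃ t, Emits A (greedy A t) ∧ bin (greedy A t).2.1 = p := by
  refine (Nat.rfind_dom (p := fun t => Part.some
    (decide (Emits A (greedy A t) ∧ (greedy A t).2.1 = unbin p)))).trans (exists_congr fun t => ?_)
  simp only [Part.mem_some_iff, Part.some_dom, implies_true, and_true]
  rw [eq_comm, decide_eq_true_iff, and_congr_right_iff]
  intro _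
  constructor
  · intro h
    rw [h, bin_unbin]
  · rintro rfl
    rw [unbin_bin _ (greedy_pos _).1]

lemma selfDelim_greedyMachine (hA : ∀ L, 2 ^ L ≤ A L) (hmono : ∀ L, 2 * A L ≤ A (L + 1))
    (hhalf : ∀ L, 2 * A L < 3 * 2 ^ L) : SelfDelim (greedyMachine A) := by
  intro p hp q hq h
  rw [mem_dom_greedyMachine] at hp hq
  obtain ⟨t, ht, rfl⟩ := hp
  obtain ⟨t', ht', rfl⟩ := hq
  rw [greedy_injOn hA hmono hhalf ht ht' h]

lemma zeta_greedyMachine (hA : ∀ L, 2 ^ L ≤ A L) (hmono : ∀ L, 2 * A L ≤ A (L + 1))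
    (hhalf : ∀ L, 2 * A L < 3 * 2 ^ L) {β : ℝ}
    (hβ : Tendsto (fun s => (A s : ℝ) / 2 ^ s) atTop (𝓝 β)) :
    zeta (greedyMachine A) = ENNReal.ofReal (β - 1) := by
  set E : Set ℕ := {t | Emits A (greedy A t)} with hE
  have hinj : Function.Injective fun t : E => (greedy A t).2.1 := by
    rintro ⟨t, ht⟩ ⟨t', ht'⟩ h
    simp only at h
    exact Subtype.ext (greedy_injOn hA hmono hhalf ht ht' (by rw [h]))
  have hrange : Ups (dom (greedyMachine A)) = Set.range fun t : E => (greedy A t).2.1 := by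
    ext n
    simp only [Ups, Set.mem_ofPred_eq, mem_dom_greedyMachine, Set.mem_range, Subtype.exists, hE]
    constructor
    · rintro ⟨hn, t, ht, h⟩
      exact ⟨t, ht, bin_injective (greedy_pos t).1 hn h⟩
    · rintro ⟨t, ht, rfl⟩
      exact ⟨(greedy_pos t).1, t, ht, rfl⟩
  have hsum : zeta (greedyMachine A) =
      ∑' t, if Emits A (greedy A t) then (((greedy A t).2.1 : ℕ) : ℝ≥0∞)⁻¹ else 0 := by
    unfold zeta
    rw [hrange, tsum_range (fun n : ℕ => (n : ℝ≥0∞)⁻¹) hinj,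
      tsum_subtype E (fun t => (((greedy A t).2.1 : ℕ) : ℝ≥0∞)⁻¹)]
    simp only [Set.indicator, hE, Set.mem_ofPred_eq]
  have hpart : ∀ k, ∑ t ∈ Finset.range k,
      (if Emits A (greedy A t) then (((greedy A t).2.1 : ℕ) : ℝ≥0∞)⁻¹ else 0) =
      ENNReal.ofReal (greedy A k).sum := by
    intro k
    induction k with
    | zero => simp [greedy, GState.sum]
    | succ k ih =>
      have hp : (0 : ℝ) < (greedy A k).2.1 := by exact_mod_cast (greedy_pos k).1
      rw [Finset.sum_range_succ, ih, sum_greedy_succ, ENNReal.ofReal_add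
        (by unfold GState.sum; positivity) (by split_ifs <;> positivity)]
      congr 1
      split_ifs
      · rw [ENNReal.ofReal_inv_of_pos hp, ENNReal.ofReal_natCast]
      · simp
  rw [hsum]
  refine tendsto_nhds_unique (ENNReal.tendsto_nat_tsum _) ?_
  simp only [hpart]
  exact ENNReal.tendsto_ofReal (tendsto_sum_greedy hA hmono hhalf hβ)

end Greedy

/-! ### Computability of the constructions -/

lemma primrec_unbin : Primrec unbin :=
  Primrec.list_foldl .id (.const 1) (Primrec.nat_add.comp
    (Primrec.nat_mul.comp (.const 2) (Primrec.fst.comp .snd))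
    ((Primrec.dom_finite Bool.toNat).comp (Primrec.snd.comp .snd))).to₂

lemma bin_zero : bin 0 = [] := by simp [bin]

lemma primrec_bin : Primrec bin := by
  have h : Primrec₂ fun (_ : Unit) n => bin n := by
    refine Primrec.nat_strong_rec (g := fun _ l => if l.length < 2 then some [] else
      (l[l.length / 2]?).map fun s => s ++ [decide (l.length % 2 = 1)]) _ ?_ ?_
    · have hl : Primrec fun x : Unit × List (List Bool) => x.2.length :=
        Primrec.list_length.comp .snd
      refine Primrec.ite (Primrec.nat_lt.comp hl (.const 2)) (.const _) ?_
      refine Primrec.option_map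
        (Primrec.list_getElem?.comp .snd (Primrec.nat_div.comp hl (.const 2))) ?_
      exact Primrec.list_concat.comp .snd
        ((Primrec.eq.comp (Primrec.nat_mod.comp (hl.comp .fst) (.const 2)) (.const 1)).decide)
    · intro _ n
      simp only [List.length_map, List.length_range]
      split_ifs with hn
      · interval_cases n <;> simp [bin_zero]
      · rw [bin_rec n (by omega), List.getElem?_map, List.getElem?_range (by omega)]
        rfl
  exact h.comp (.const ()) .id

lemma primrec_pow : Primrec₂ ((· ^ ·) : ℕ → ℕ → ℕ) := Primrec₂.unpaired'.1 Nat.Primrec.pow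

lemma primrecRel_pat : PrimrecRel Pat := by
  have hs : Primrec fun x : ℕ × ℕ => Nat.sqrt x.1 := Primrec.nat_sqrt.comp .fst
  have h1 : PrimrecPred fun x : ℕ × ℕ => Nat.sqrt x.1 * Nat.sqrt x.1 = x.1 :=
    Primrec.eq.comp (Primrec.nat_mul.comp hs hs) .fst
  have h2 : PrimrecPred fun x : ℕ × ℕ => x.2 % 2 = (Nat.sqrt x.1 + 1) % 2 :=
    Primrec.eq.comp (Primrec.nat_mod.comp .snd (.const 2))
      (Primrec.nat_mod.comp (Primrec.succ.comp hs) (.const 2))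
  exact (h1.not.or h2).of_eq fun x => by unfold Pat; tauto

lemma primrec_inTree {α : Type*} [Primcodable α] {Ok : α → ℕ → ℕ → Prop}
    (h : PrimrecPred fun x : α × ℕ × ℕ => Ok x.1 x.2.1 x.2.2) :
    PrimrecPred fun x : α × ℕ × ℕ => InTree (Ok x.1) x.2.1 x.2.2 := by
  have h1 : PrimrecRel fun (i : ℕ) (x : α × ℕ × ℕ) => Ok x.1 (x.2.1 - i) (x.2.2 / 2 ^ i) := by
    have hf : Primrec fun y : ℕ × α × ℕ × ℕ => (y.2.1, y.2.2.1 - y.1, y.2.2.2 / 2 ^ y.1) :=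
      .pair (Primrec.fst.comp .snd) (.pair
        (Primrec.nat_sub.comp (Primrec.fst.comp (Primrec.snd.comp .snd)) .fst)
        (Primrec.nat_div.comp (Primrec.snd.comp (Primrec.snd.comp .snd))
          (primrec_pow.comp (.const 2) .fst)))
    exact (h.comp hf :)
  have h2 : PrimrecPred fun x : α × ℕ × ℕ => x.2.2 / 2 ^ x.2.1 = 1 :=
    Primrec.eq.comp (Primrec.nat_div.comp (Primrec.snd.comp .snd)
      (primrec_pow.comp (.const 2) (Primrec.fst.comp .snd))) (.const 1)
  have h3 : PrimrecRel fun (m : ℕ) (x : α × ℕ × ℕ) =>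
      ∀ i < m, Ok x.1 (x.2.1 - i) (x.2.2 / 2 ^ i) :=
    (h1.forall_mem_list.comp (Primrec.list_range.comp .fst) .snd).of_eq (by simp)
  have h4 : PrimrecPred fun x : α × ℕ × ℕ => ∀ i < x.2.1, Ok x.1 (x.2.1 - i) (x.2.2 / 2 ^ i) :=
    h3.comp (g := fun x => x) (Primrec.fst.comp .snd) Primrec.id
  exact (h2.and h4).of_eq fun x => tree_iff.symm

open Nat.Partrec (Code)

/-- `n` has a program that is much shorter than `i`, found within `s` steps. -/
def BadAt (c : Code) (s i n : ℕ) : Prop :=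
  ∃ q < 2 ^ i, (1 ≤ q ∧ q * 32 ^ Nat.sqrt i < 2 ^ i) ∧ c.evaln s q = some n

lemma primrec_badAt (c : Code) : PrimrecPred fun x : ℕ × ℕ × ℕ => BadAt c x.1 x.2.1 x.2.2 := by
  have h1 : PrimrecRel fun (q : ℕ) (x : ℕ × ℕ × ℕ) =>
      (1 ≤ q ∧ q * 32 ^ Nat.sqrt x.2.1 < 2 ^ x.2.1) ∧ c.evaln x.1 q = some x.2.2 := by
    have hi : Primrec fun y : ℕ × ℕ × ℕ × ℕ => y.2.2.1 := Primrec.fst.comp (Primrec.snd.comp .snd)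
    have a1 : PrimrecPred fun y : ℕ × ℕ × ℕ × ℕ => 1 ≤ y.1 := Primrec.nat_le.comp (.const 1) .fst
    have a2 : PrimrecPred fun y : ℕ × ℕ × ℕ × ℕ => y.1 * 32 ^ Nat.sqrt y.2.2.1 < 2 ^ y.2.2.1 :=
      Primrec.nat_lt.comp (Primrec.nat_mul.comp .fst
        (primrec_pow.comp (.const 32) (Primrec.nat_sqrt.comp hi))) (primrec_pow.comp (.const 2) hi)
    have a3 : PrimrecPred fun y : ℕ × ℕ × ℕ × ℕ => c.evaln y.2.1 y.1 = some y.2.2.2 :=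
      Primrec.eq.comp (Code.primrec_evaln.comp
        (.pair (.pair (Primrec.fst.comp .snd) (.const c)) .fst))
        (Primrec.option_some.comp (Primrec.snd.comp (Primrec.snd.comp .snd)))
    exact ((a1.and a2).and a3 :)
  have h2 : PrimrecRel fun (m : ℕ) (x : ℕ × ℕ × ℕ) => ∃ q < m,
      (1 ≤ q ∧ q * 32 ^ Nat.sqrt x.2.1 < 2 ^ x.2.1) ∧ c.evaln x.1 q = some x.2.2 :=
    (h1.exists_mem_list.comp (Primrec.list_range.comp .fst) .snd).of_eq (by simp)
  exact h2.comp (g := fun x => x) (primrec_pow.comp (.const 2) (Primrec.fst.comp .snd)) Primrec.id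

lemma BadAt.mono {c : Code} {s s' i n : ℕ} (hs : s ≤ s') (h : BadAt c s i n) : BadAt c s' i n := by
  obtain ⟨q, hq, h1, h2⟩ := h
  exact ⟨q, hq, h1, Code.evaln_mono hs h2⟩

/-- The strings excluded at any stage are few. -/
lemma card_bad (c : Code) : ∃ B : ℕ → Finset ℕ,
    (∀ i n, (∃ s, BadAt c s i n) → n ∈ B i) ∧ ∀ i, (B i).card * 32 ^ Nat.sqrt i ≤ 2 ^ i := by
  classical
  refine ⟨fun i => (Finset.Icc 1 (2 ^ i / 32 ^ Nat.sqrt i)).image fun q =>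
    if h : (c.eval q).Dom then (c.eval q).get h else 0, ?_, fun i => ?_⟩
  · rintro i n ⟨s, q, -, ⟨h1, h2⟩, h3⟩
    have h4 : n ∈ c.eval q := Code.evaln_sound h3
    refine Finset.mem_image.2 ⟨q, Finset.mem_Icc.2 ⟨h1, ?_⟩, ?_⟩
    · rw [Nat.le_div_iff_mul_le (by positivity)]
      exact h2.le
    · rw [dif_pos h4.1]
      exact h4.2
  · refine (Nat.mul_le_mul_right _ Finset.card_image_le).trans ?_
    rw [Nat.card_Icc, Nat.add_sub_cancel]
    exact Nat.div_mul_le_self _ _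

lemma exists_computable_least {R : ℕ → ℕ → Prop} (hR : PrimrecRel R) (h : ∀ L, ∃ n, R L n) :
    ∃ A : ℕ → ℕ, Computable A ∧ (∀ L, R L (A L)) ∧ ∀ L n, R L n → A L ≤ n := by
  classical
  refine ⟨fun L => Nat.find (h L), ?_, fun L => Nat.find_spec (h L),
    fun L n hn => Nat.find_min' (h L) hn⟩
  have h1 : Partrec fun L => Nat.rfind fun n => Part.some (decide (R L n)) :=
    Partrec.rfind hR.decide.to_comp.partrec₂
  refine h1.of_eq fun L => Part.eq_some_iff.2 (Nat.mem_rfind.2 ⟨?_, fun hm => ?_⟩)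
  · simpa using Nat.find_spec (h L)
  simpa using Nat.find_min (h L) hm

/-- Computable approximations to the leftmost path through the incompressible strings with
forced digits. -/
lemma exists_approx (c : Code) : ∃ A : ℕ → ℕ, Computable A ∧
    (∀ s, InTree (fun i n => Pat i n ∧ ¬ BadAt c s i n) s (A s)) ∧ ∀ s, 2 * A s ≤ A (s + 1) := by
  obtain ⟨B, hB, hcard⟩ := card_bad c
  have hP : PrimrecPred fun x : ℕ × ℕ × ℕ => Pat x.2.1 x.2.2 ∧ ¬ BadAt c x.1 x.2.1 x.2.2 :=
    (primrecRel_pat.comp (Primrec.fst.comp .snd) (Primrec.snd.comp .snd)).and (primrec_badAt c).not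
  have hR : PrimrecRel fun s n => InTree (fun i n => Pat i n ∧ ¬ BadAt c s i n) s n :=
    (primrec_inTree (Ok := fun s i n => Pat i n ∧ ¬ BadAt c s i n) hP).comp
      (Primrec.pair .fst (.pair .fst .snd))
  obtain ⟨A, hA, h1, h2⟩ := exists_computable_least hR fun s => by
    obtain ⟨n, hn⟩ := exists_tree B hB hcard s
    exact ⟨n, hn.mono fun i n h => ⟨h.1, fun hb => h.2 ⟨s, hb⟩⟩⟩
  refine ⟨A, hA, h1, fun s => ?_⟩
  have h3 := h2 s _ ((h1 (s + 1)).1.mono fun i n h =>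
    ⟨h.1, fun hb => h.2 (hb.mono (Nat.le_succ s))⟩)
  omega

lemma computable_emits {A : ℕ → ℕ} (hA : Computable A) :
    Computable fun x : GState => decide (Emits A x) := by
  have hL : Computable fun x : GState => x.1 := .fst
  have hn : Computable fun x : GState => x.2.1 := Computable.fst.comp .snd
  have hp : Computable fun x : GState => x.2.2.1 := Computable.fst.comp (Computable.snd.comp .snd)
  have hq : Computable fun x : GState => x.2.2.2 := Computable.snd.comp (Computable.snd.comp .snd)
  have hpow : Computable fun x : GState => 2 ^ x.1 := primrec_pow.to_comp.comp (.const 2) hL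
  have hmul : Computable₂ ((· * ·) : ℕ → ℕ → ℕ) := Primrec.nat_mul.to_comp
  have hadd : Computable₂ ((· + ·) : ℕ → ℕ → ℕ) := Primrec.nat_add.to_comp
  have hsub : Computable₂ ((· - ·) : ℕ → ℕ → ℕ) := Primrec.nat_sub.to_comp
  have hle : Computable₂ fun a b : ℕ => decide (a ≤ b) := Primrec.nat_le.decide.to_comp
  exact (hle.comp (hmul.comp hpow (hadd.comp hq (hmul.comp hn hp)))
    (hmul.comp (hsub.comp (hA.comp hL) hpow) (hmul.comp hn hq))).of_eq fun x => by
      congr 1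

lemma computable_greedy {A : ℕ → ℕ} (hA : Computable A) : Computable (greedy A) := by
  have hL : Computable fun x : GState => x.1 := .fst
  have hn : Computable fun x : GState => x.2.1 := Computable.fst.comp .snd
  have hp : Computable fun x : GState => x.2.2.1 := Computable.fst.comp (Computable.snd.comp .snd)
  have hq : Computable fun x : GState => x.2.2.2 := Computable.snd.comp (Computable.snd.comp .snd)
  have hmul : Computable₂ ((· * ·) : ℕ → ℕ → ℕ) := Primrec.nat_mul.to_comp
  have hadd : Computable₂ ((· + ·) : ℕ → ℕ → ℕ) := Primrec.nat_add.to_comp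
  have hstep : Computable (greedyStep A) := by
    refine (Computable.cond (computable_emits hA)
      (hL.pair ((hadd.comp hn (.const 1)).pair ((hadd.comp (hmul.comp hp hn) hq).pair
        (hmul.comp hq hn))))
      ((hadd.comp hL (.const 1)).pair ((hmul.comp (.const 2) hn).pair (hp.pair hq)))).of_eq
      fun x => ?_
    unfold greedyStep
    split_ifs with h <;> simp [h]
  exact Computable.nat_rec .id (.const _) (hstep.comp (Computable.snd.comp .snd)).to₂

lemma partrec_greedyMachine {A : ℕ → ℕ} (hA : Computable A) : Partrec (greedyMachine A) := by
  have hx : Computable fun y : List Bool × ℕ => greedy A y.2 :=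
    (computable_greedy hA).comp .snd
  have h1 : Computable₂ fun (p : List Bool) t =>
      decide (Emits A (greedy A t) ∧ (greedy A t).2.1 = unbin p) := by
    have h2 : Computable fun y : List Bool × ℕ => decide ((greedy A y.2).2.1 = unbin y.1) :=
      (Primrec.eq (α := ℕ)).decide.to_comp.comp (Computable.fst.comp (Computable.snd.comp hx))
        (primrec_unbin.to_comp.comp .fst)
    exact (Primrec.and.to_comp.comp ((computable_emits hA).comp hx) h2).of_eq fun y => by simp
  exact (Partrec.rfind h1.partrec₂).map (Computable.const []).to₂

/-! ### Strings with forced digits have short self-delimiting descriptions -/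

open Classical in
/-- The number of strings of length `m` with forced digits that precede `n`. -/
noncomputable def rank (m n : ℕ) : ℕ := Nat.count (InTree Pat m) n

lemma primrec_rank : Primrec₂ rank := by
  classical
  have hR : PrimrecRel fun (n m : ℕ) => InTree Pat m n :=
    (primrec_inTree (α := Unit) (Ok := fun _ => Pat) (primrecRel_pat.comp (Primrec.fst.comp .snd)
      (Primrec.snd.comp .snd))).comp (Primrec.pair (.const ()) (.pair .snd .fst))
  exact (Primrec.list_length.comp (hR.listFilter.comp (Primrec.list_range.comp .snd) .fst)).of_eq
    fun x => by rw [rank, Nat.count, List.countP_eq_length_filter]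

lemma rank_lt {m n : ℕ} (h : InTree Pat m n) : rank m n * 2 ^ Nat.sqrt m < 2 ^ m := by
  classical
  rw [← card_level_pat m]
  refine Nat.mul_lt_mul_of_pos_right ?_ (by positivity)
  rw [rank, Nat.count_eq_card_filter_range]
  apply Finset.card_lt_card
  refine ⟨fun a ha => mem_level.2 (Finset.mem_filter.1 ha).2, fun hsub => ?_⟩
  have := hsub (mem_level.2 h)
  simp at this

/-- The description of `n` as a string of length `4 * k ^ 2` with forced digits. -/
noncomputable def descr (k n : ℕ) : List Bool :=
  (List.range k).map (fun _ => true) ++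
    false :: bin (2 ^ (4 * k * k - 2 * k) + rank (4 * k * k) n)

lemma sqrt_four_mul (k : ℕ) : Nat.sqrt (4 * k * k) = 2 * k := by
  rw [show 4 * k * k = (2 * k) * (2 * k) by ring, Nat.sqrt_eq]

lemma length_descr {k n : ℕ} (h : InTree Pat (4 * k * k) n) :
    (descr k n).length = k + 1 + (4 * k * k - 2 * k) := by
  have h1 := rank_lt h
  have h2 : 2 * k ≤ 4 * k * k := by nlinarith [Nat.le_mul_self k]
  rw [sqrt_four_mul] at h1
  have h3 : rank (4 * k * k) n < 2 ^ (4 * k * k - 2 * k) := by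
    refine Nat.lt_of_mul_lt_mul_right (a := 2 ^ (2 * k)) ?_
    rwa [← pow_add, Nat.sub_add_cancel h2]
  rw [descr, List.length_append, List.length_cons, length_bin (Nat.le_add_right _ _)
    (by rw [pow_succ]; omega)]
  simp
  omega

lemma idxOf_descr (k n : ℕ) : (descr k n).idxOf false = k := by
  rw [descr, List.idxOf_append_of_notMem (by simp)]
  simp

lemma descr_injective {k n n' : ℕ} (h : InTree Pat (4 * k * k) n) (h' : InTree Pat (4 * k * k) n')
    (he : descr k n = descr k n') : n = n' := by
  classical
  have h1 := List.append_cancel_left he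
  rw [List.cons.injEq] at h1
  have hp : 1 ≤ 2 ^ (4 * k * k - 2 * k) := Nat.one_le_two_pow
  have h2 := bin_injective (by omega) (by omega) h1.2
  exact Nat.count_injective h h' (Nat.add_left_cancel h2)

open Classical in
/-- The machine that inverts `descr`. -/
noncomputable def descrMachine (p : List Bool) : Part (List Bool) :=
  (Nat.rfind fun n => Part.some (decide (InTree Pat (4 * p.idxOf false * p.idxOf false) n ∧
    p = descr (p.idxOf false) n))).map bin

open Classical in
lemma mem_descrMachine {p y : List Bool} (h : y ∈ descrMachine p) :
    ∃ k n, InTree Pat (4 * k * k) n ∧ p = descr k n ∧ bin n = y := by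
  obtain ⟨n, hn, rfl⟩ := (Part.mem_map_iff _).1 h
  have := Nat.rfind_spec hn
  rw [Part.mem_some_iff, eq_comm, decide_eq_true_iff] at this
  exact ⟨_, n, this.1, this.2, rfl⟩

open Classical in
lemma descrMachine_descr {k n : ℕ} (h : InTree Pat (4 * k * k) n) :
    bin n ∈ descrMachine (descr k n) := by
  have hd : (descrMachine (descr k n)).Dom := by
    refine Nat.rfind_dom.2 ⟨n, ?_, fun _ => trivial⟩
    rw [Part.mem_some_iff, eq_comm, decide_eq_true_iff, idxOf_descr]
    exact ⟨h, rfl⟩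
  obtain ⟨y, hy⟩ := Part.dom_iff_mem.1 hd
  obtain ⟨k', n', h1, h2, rfl⟩ := mem_descrMachine hy
  have h3 : k = k' := by rw [← idxOf_descr k n, h2, idxOf_descr]
  subst h3
  rwa [← descr_injective h h1 h2] at hy

lemma selfDelim_descrMachine : SelfDelim descrMachine := by
  intro p hp q hq hpq
  obtain ⟨y, hy⟩ := Part.dom_iff_mem.1 (show (descrMachine p).Dom from hp)
  obtain ⟨z, hz⟩ := Part.dom_iff_mem.1 (show (descrMachine q).Dom from hq)
  obtain ⟨k, n, h1, rfl, -⟩ := mem_descrMachine hy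
  obtain ⟨k', n', h1', rfl, -⟩ := mem_descrMachine hz
  have hk : k = k' := by
    obtain ⟨r, hr⟩ := hpq
    have h2 := congrArg (List.idxOf false) hr
    rwa [List.idxOf_append_of_mem (by simp [descr]), idxOf_descr, idxOf_descr] at h2
  subst hk
  exact hpq.eq_of_length (by rw [length_descr h1, length_descr h1'])

lemma primrec_descr : Primrec₂ descr := by
  have hk : Primrec fun x : ℕ × ℕ => 4 * x.1 * x.1 :=
    Primrec.nat_mul.comp (Primrec.nat_mul.comp (.const 4) .fst) .fst
  exact Primrec.list_append.comp
    (Primrec.list_map (Primrec.list_range.comp .fst) (Primrec.const true).to₂)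
    (Primrec.list_cons.comp (.const false) (primrec_bin.comp (Primrec.nat_add.comp
      (primrec_pow.comp (.const 2) (Primrec.nat_sub.comp hk (Primrec.nat_mul.comp (.const 2) .fst)))
      (primrec_rank.comp hk .snd))))

lemma partrec_descrMachine : Partrec descrMachine := by
  classical
  have hk : Primrec fun x : List Bool × ℕ => x.1.idxOf false :=
    Primrec.list_idxOf.comp (.const false) .fst
  have h1 : PrimrecPred fun x : List Bool × ℕ =>
      InTree Pat (4 * x.1.idxOf false * x.1.idxOf false) x.2 :=
    (primrec_inTree (α := Unit) (Ok := fun _ => Pat) (primrecRel_pat.comp (Primrec.fst.comp .snd)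
      (Primrec.snd.comp .snd))).comp (Primrec.pair (.const ())
        (.pair (Primrec.nat_mul.comp (Primrec.nat_mul.comp (.const 4) hk) hk) .snd))
  have h2 : PrimrecRel fun (p : List Bool) n =>
      InTree Pat (4 * p.idxOf false * p.idxOf false) n ∧ p = descr (p.idxOf false) n :=
    h1.and (Primrec.eq.comp .fst (primrec_descr.comp hk .snd))
  exact ((Partrec.rfind h2.decide.to_comp.partrec₂).map (primrec_bin.to_comp.comp .snd).to₂).of_eq
    fun p => by unfold descrMachine; congr! 6

lemma Cpx_le {f : List Bool →. List Bool} {w y : List Bool} (h : y ∈ f w) : Cpx f y ≤ w.length :=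
  Nat.sInf_le ⟨w, rfl, h⟩

lemma UnivSD.exists_const {U : List Bool →. List Bool} (hU : UnivSD U) :
    ∃ c : ℕ, ∀ k n, InTree Pat (4 * k * k) n →
      Cpx U (bin n) ≤ k + 1 + (4 * k * k - 2 * k) + c := by
  obtain ⟨c, hc⟩ := hU.2 _ partrec_descrMachine selfDelim_descrMachine
  refine ⟨c, fun k n h => ?_⟩
  have hm := descrMachine_descr h
  obtain ⟨p, hp, he⟩ := hc (descr k n) (Part.dom_iff_mem.2 ⟨_, hm⟩)
  rw [length_descr h] at hp
  exact (Cpx_le (he ▸ hm)).trans hp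

/-! ### The main theorem -/

lemma UnivTM.exists_mem {T : List Bool →. List Bool} (hT : UnivTM T) (y : List Bool) :
    ∃ w, y ∈ T w := by
  obtain ⟨c, hc⟩ := hT (fun p => Part.some p) Computable.id.partrec
  obtain ⟨p, -, hp⟩ := hc y trivial
  exact ⟨p, hp ▸ Part.mem_some y⟩

lemma Cpx_spec {T : List Bool →. List Bool} (hT : UnivTM T) (y : List Bool) :
    ∃ w : List Bool, w.length = Cpx T y ∧ y ∈ T w := by
  obtain ⟨w, hw⟩ := hT.exists_mem y
  exact Nat.sInf_mem (s := {n | ∃ w : List Bool, w.length = n ∧ y ∈ T w}) ⟨_, w, rfl, hw⟩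

lemma exists_code {T : List Bool →. List Bool} (hT : Partrec T) :
    ∃ c : Code, ∀ q n, 1 ≤ n → bin n ∈ T (bin q) → n ∈ c.eval q := by
  have h1 : Partrec fun q => (T (bin q)).map unbin :=
    (hT.comp primrec_bin.to_comp).map (primrec_unbin.to_comp.comp .snd).to₂
  obtain ⟨c, hc⟩ := Code.exists_code.1 (Partrec.nat_iff.1 h1)
  refine ⟨c, fun q n hn h => ?_⟩
  rw [hc]
  exact (Part.mem_map_iff _).2 ⟨_, h, unbin_bin n hn⟩

/-- A string that is never excluded has no program that is much shorter than itself. -/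
lemma le_Cpx_add {T : List Bool →. List Bool} (hT : UnivTM T) {c : Code}
    (hc : ∀ q n, 1 ≤ n → bin n ∈ T (bin q) → n ∈ c.eval q) {m n : ℕ} (hn : 1 ≤ n)
    (h : ∀ s, ¬ BadAt c s m n) : m ≤ Cpx T (bin n) + 5 * Nat.sqrt m := by
  obtain ⟨w, hw, hm⟩ := Cpx_spec hT (bin n)
  rw [← hw]
  have hev : n ∈ c.eval (unbin w) :=
    hc _ _ hn (by rwa [bin_unbin])
  obtain ⟨s, hs⟩ := Code.evaln_complete.1 hev
  by_contra hlt
  refine h s ⟨unbin w, ?_, ⟨unbin_pos w, ?_⟩, hs⟩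
  · exact (unbin_lt w).trans_le (Nat.pow_le_pow_right (by norm_num) (by omega))
  · rw [show 32 = 2 ^ 5 by norm_num, ← pow_mul]
    calc unbin w * 2 ^ (5 * Nat.sqrt m) < 2 ^ (w.length + 1) * 2 ^ (5 * Nat.sqrt m) :=
          Nat.mul_lt_mul_of_pos_right (unbin_lt w) (by positivity)
      _ = 2 ^ (w.length + 1 + 5 * Nat.sqrt m) := (pow_add _ _ _).symm
      _ ≤ 2 ^ m := Nat.pow_le_pow_right (by norm_num) (by omega)

lemma five_mul_sqrt_le {ε : ℝ} (hε : 0 < ε) (m : ℕ) :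
    5 * (Nat.sqrt m : ℝ) ≤ ε * m + 25 / (4 * ε) := by
  have h1 : (Nat.sqrt m : ℝ) * Nat.sqrt m ≤ m := mod_cast Nat.sqrt_le m
  have h2 : 0 ≤ (2 * ε * Nat.sqrt m - 5) ^ 2 / (4 * ε) := by positivity
  have h3 : (2 * ε * (Nat.sqrt m : ℝ) - 5) ^ 2 / (4 * ε) =
      ε * (Nat.sqrt m * Nat.sqrt m) - 5 * Nat.sqrt m + 25 / (4 * ε) := by
    field_simp
    ring
  nlinarith

lemma InTree.two_mul_lt {Ok : ℕ → ℕ → Prop} (hOk : ∀ i n, Ok i n → Pat i n) {m n : ℕ}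
    (h : InTree Ok m n) : 2 * n < 3 * 2 ^ m := by
  rcases Nat.eq_zero_or_pos m with rfl | hm
  · have : n = 1 := h
    omega
  · obtain ⟨j, rfl⟩ : ∃ j, m = 1 + j := ⟨m - 1, by omega⟩
    have h1 := (h.mono hOk).div
    have h2 := h1.bounds
    have h3 := h1.last le_rfl (by decide)
    rw [Nat.sqrt_one] at h3
    have h4 : n / 2 ^ j < 3 := by omega
    rw [Nat.div_lt_iff_lt_mul (by positivity)] at h4
    rw [pow_add]
    omega

/-- There exists a self-delimiting Turing machine `V` whose zeta number is
asymptotically random but not random. -/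
theorem stmt_16 (T : List Bool →. List Bool) (hT : Partrec T) (hTuniv : UnivTM T)
    (U : List Bool →. List Bool) (hU : Partrec U) (hUuniv : UnivSD U) :
    ∃ V : List Bool →. List Bool, Partrec V ∧ SelfDelim V ∧
      ∀ x : ℕ → Bool, zeta V = ennDigits x →
        (∀ s : ℝ, ComputableReal s → 1 < s →
          ∃ c : ℝ, 0 ≤ c ∧ ∀ m : ℕ, 1 ≤ m →
            (Cpx T (prefixStr x m) : ℝ) ≥ m / s - c) ∧
        ¬ (∃ c' : ℝ, 0 ≤ c' ∧ ∀ m : ℕ, 1 ≤ m →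
            (Cpx U (prefixStr x m) : ℝ) ≥ m - c') := by
  obtain ⟨c, hc⟩ := exists_code hT
  obtain ⟨A, hAc, hAt, hmono⟩ := exists_approx c
  have hA : ∀ L, 2 ^ L ≤ A L := fun L => (hAt L).bounds.1
  have hhalf : ∀ L, 2 * A L < 3 * 2 ^ L := fun L => (hAt L).two_mul_lt fun _ _ h => h.1
  obtain ⟨β, hβ⟩ : ∃ β : ℝ, Tendsto (fun s => (A s : ℝ) / 2 ^ s) atTop (𝓝 β) := by
    refine ⟨_, tendsto_atTop_ciSup (approx_monotone hmono) ⟨2, ?_⟩⟩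
    rintro _ ⟨s, rfl⟩
    have : (A s : ℝ) < 2 ^ (s + 1) := mod_cast (hAt s).bounds.2
    rw [div_le_iff₀ (by positivity)]
    rw [pow_succ] at this
    linarith
  have hβ1 : 1 ≤ β := ge_of_tendsto' hβ fun s => by
    rw [one_le_div (by positivity)]
    exact mod_cast hA s
  refine ⟨greedyMachine A, partrec_greedyMachine hAc, selfDelim_greedyMachine hA hmono hhalf,
    fun x hx => ?_⟩
  rw [zeta_greedyMachine hA hmono hhalf hβ] at hx
  have hpath := exists_path (Ok := fun s i n => Pat i n ∧ ¬ BadAt c s i n)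
    (fun s s' i n hs h => ⟨h.1, fun hb => h.2 (hb.mono hs)⟩) hAt hmono
  have hX : ∀ m, InTree (fun i n => ∀ s, Pat i n ∧ ¬ BadAt c s i n) m
      (unbin (prefixStr x m)) := fun m => by
    obtain ⟨N, hN⟩ := path_unique hβ (fun m => by
      obtain ⟨y, N, h1, h2⟩ := hpath m
      exact ⟨y, N, h1, h2.mono fun i n h => (h 0).1⟩) (tendsto_prefixStr hβ1 hx.symm)
      (unbin_prefixStr_div x) m
    obtain ⟨y, N', h1, h2⟩ := hpath m
    rwa [← hN _ (le_max_left N N'), h1 _ (le_max_right N N')]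
  constructor
  · intro s _ hs
    have hε : 0 < 1 - 1 / s := by
      rw [sub_pos, div_lt_one (by linarith)]
      exact hs
    refine ⟨25 / (4 * (1 - 1 / s)), by positivity, fun m hm => ?_⟩
    have h1 := le_Cpx_add hTuniv hc (unbin_pos (prefixStr x m)) fun s => ((hX m).last hm s).2
    rw [bin_unbin] at h1
    have h2 : (m : ℝ) ≤ Cpx T (prefixStr x m) + 5 * (Nat.sqrt m : ℝ) := mod_cast h1
    have h3 := five_mul_sqrt_le hε m
    have h4 : (m : ℝ) / s = m - (1 - 1 / s) * m := by ring
    linarith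
  · rintro ⟨c', -, h⟩
    obtain ⟨d, hd⟩ := hUuniv.exists_const
    obtain ⟨k, hk⟩ := exists_nat_gt (c' + d + 1)
    have hk' : 1 ≤ k + 1 := by omega
    have h1 := h (4 * (k + 1) * (k + 1)) (by nlinarith)
    have h2 := hd (k + 1) _ ((hX _).mono fun i n h => (h 0).1)
    rw [bin_unbin] at h2
    have h3 : Cpx U (prefixStr x (4 * (k + 1) * (k + 1))) + (k + 1) ≤
        4 * (k + 1) * (k + 1) + 1 + d := by
      have : 2 * (k + 1) ≤ 4 * (k + 1) * (k + 1) := by nlinarith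
      omega
    have h4 : (Cpx U (prefixStr x (4 * (k + 1) * (k + 1))) : ℝ) + (k + 1) ≤
        (4 * (k + 1) * (k + 1) : ℕ) + 1 + d := mod_cast h3
    linarith
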